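/- arXiv:2205.08691 — 2 statements merged into one kernel-verified Lean document; each statement's English description precedes it below -/
import Mathlib

section
/- Let w be a right-special word having 0 B_n as a suffix. Then n > 1 and w is a suffix of ((B_{n-1} 1)^{gamma_{n-1}} B_{n-1})^{L_{n-1} - 1} B_n. -/
/-- The word sequence `B 1 = 0`, `B (n+1) = ((B n 1)^{γ n} B n)^{L n}` over the alphabet
`{0,1}` (encoded as `Bool` with `false = 0`, `true = 1`). The value at `0` is an
irrelevant placeholder. -/
def Cseq (L γ : ℕ → ℕ) : ℕ → List Bool
  | 0 => [false]
  | 1 => [false]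
  | n + 2 =>
      (List.replicate (L (n + 1))
        ((List.replicate (γ (n + 1)) (Cseq L γ (n + 1) ++ [true])).flatten ++
          Cseq L γ (n + 1))).flatten

/-- The language: all factors of some `B n`. -/
def InLangC (L γ : ℕ → ℕ) (w : List Bool) : Prop :=
  ∃ n, w <:+: Cseq L γ n

/-- The word complexity: the number of words of length `q` in the language. -/
noncomputable def complexityC (L γ : ℕ → ℕ) (q : ℕ) : ℕ :=
  Set.ncard {w : List Bool | w.length = q ∧ InLangC L γ w}

/-- A word `w` is right-special if both `w0` and `w1` belong to the language. -/
def RightSpecialC (L γ : ℕ → ℕ) (w : List Bool) : Prop :=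
  InLangC L γ (w ++ [false]) ∧ InLangC L γ (w ++ [true])

/-- The word `f b₁ f b₂ f ⋯ b_k f` obtained by separating copies of `f` by the letters of `g`. -/
def sepJoin (f g : List Bool) : List Bool :=
  f ++ g.flatMap (fun b => b :: f)

/-- Copies of `B` separated by spacers: a letter `true` of `t` inserts the letter `1` between two
consecutive copies of `B`, a letter `false` inserts nothing. -/
def spacerJoin (B t : List Bool) : List Bool :=
  B ++ t.flatMap (fun b => (if b then [true] else []) ++ B)

@[simp] lemma sepJoin_nil (f : List Bool) : sepJoin f [] = f := by simp [sepJoin]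

@[simp] lemma sepJoin_cons (f g : List Bool) (b : Bool) :
    sepJoin f (b :: g) = f ++ b :: sepJoin f g := by simp [sepJoin]

@[simp] lemma sepJoin_append_cons (f g g' : List Bool) (b : Bool) :
    sepJoin f (g ++ b :: g') = sepJoin f g ++ b :: sepJoin f g' := by
  simp [sepJoin]

@[simp] lemma spacerJoin_nil (B : List Bool) : spacerJoin B [] = B := by simp [spacerJoin]

@[simp] lemma spacerJoin_cons (B t : List Bool) (b : Bool) :
    spacerJoin B (b :: t) = B ++ ((if b then [true] else []) ++ spacerJoin B t) := by
  simp [spacerJoin]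

@[simp] lemma spacerJoin_append_cons (B t t' : List Bool) (b : Bool) :
    spacerJoin B (t ++ b :: t') =
      spacerJoin B t ++ ((if b then [true] else []) ++ spacerJoin B t') := by
  simp [spacerJoin]

/-- Spacer words compose. -/
lemma spacerJoin_spacerJoin (B f g : List Bool) :
    spacerJoin (spacerJoin B f) g = spacerJoin B (sepJoin f g) := by
  induction g with
  | nil => simp
  | cons b g ih => simp [ih]

lemma sepJoin_sepJoin (f z g : List Bool) :
    sepJoin (sepJoin f z) g = sepJoin f (sepJoin z g) := by
  induction g with
  | nil => simp
  | cons b g ih => simp [ih]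

/-- A letter that does not occur in `f` is a separator wherever it occurs in `sepJoin f g`. -/
lemma exists_of_sepJoin_eq {f : List Bool} {x : Bool} (hx : x ∉ f) (g : List Bool) :
    ∀ p r : List Bool, sepJoin f g = p ++ x :: r →
      ∃ g₁ g₂, g = g₁ ++ x :: g₂ ∧ p = sepJoin f g₁ ∧ r = sepJoin f g₂ := by
  induction g with
  | nil =>
    intro p r h
    simp only [sepJoin_nil] at h
    simp [h] at hx
  | cons b g ih =>
    intro p r h
    rw [sepJoin_cons, List.append_eq_append_iff] at h
    rcases h with ⟨a, rfl, h⟩ | ⟨a, rfl, h⟩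
    · cases a with
      | nil =>
        simp only [List.nil_append, List.cons.injEq] at h
        obtain ⟨rfl, rfl⟩ := h
        exact ⟨[], g, by simp, by simp, rfl⟩
      | cons c a =>
        simp only [List.cons_append, List.cons.injEq] at h
        obtain ⟨rfl, h⟩ := h
        obtain ⟨g₁, g₂, rfl, rfl, rfl⟩ := ih _ _ h
        exact ⟨b :: g₁, g₂, by simp, by simp, rfl⟩
    · cases a with
      | nil =>
        simp only [List.nil_append, List.cons.injEq] at h
        obtain ⟨rfl, rfl⟩ := h
        exact ⟨[], g, by simp, by simp, rfl⟩
      | cons c a =>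
        simp only [List.cons_append, List.cons.injEq] at h
        obtain ⟨rfl, -⟩ := h
        simp at hx

lemma exists_of_sepJoin_append {f : List Bool} (x : List Bool) :
    ∀ (y : List Bool) (a : Bool) (s : List Bool), sepJoin f x ++ a :: s = sepJoin f y →
      ∃ r, y = x ++ a :: r := by
  induction x with
  | nil =>
    intro y a s h
    cases y with
    | nil => simp at h
    | cons b y =>
      simp only [sepJoin_nil, sepJoin_cons, List.append_cancel_left_eq, List.cons.injEq] at h
      exact ⟨y, by simp [h.1]⟩
  | cons c x ih =>
    intro y a s h
    cases y with
    | nil => simp at h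
    | cons b y =>
      simp only [sepJoin_cons, List.append_assoc, List.cons_append, List.append_cancel_left_eq,
        List.cons.injEq] at h
      obtain ⟨r, rfl⟩ := ih _ _ _ h.2
      exact ⟨r, by simp [h.1]⟩

lemma prefix_of_spacerJoin_append {B : List Bool} (hB : B.head? = some false) (x : List Bool) :
    ∀ y q : List Bool, spacerJoin B x ++ q = spacerJoin B y → ∃ r, y = x ++ r := by
  obtain ⟨B, rfl⟩ : ∃ B', B = false :: B' := by
    cases B <;> simp_all
  induction x with
  | nil => exact fun y q _ => ⟨y, rfl⟩
  | cons c x ih =>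
    intro y q h
    cases y with
    | nil => cases c <;> cases x <;> simp at h
    | cons b y =>
      rw [spacerJoin_cons, spacerJoin_cons, List.append_assoc, List.append_cancel_left_eq] at h
      have hbc : c = b := by
        cases c <;> cases b <;> cases x <;> cases y <;> simp at h <;> rfl
      subst hbc
      rw [List.append_assoc, List.append_cancel_left_eq] at h
      obtain ⟨r, rfl⟩ := ih _ _ h
      exact ⟨r, rfl⟩

lemma exists_of_spacerJoin_append_cons {B : List Bool} (hB : B.head? = some false)
    {x y q : List Bool} {a : Bool} (h : spacerJoin B x ++ a :: q = spacerJoin B y) :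
    ∃ r, y = x ++ a :: r := by
  obtain ⟨r, rfl⟩ := prefix_of_spacerJoin_append hB x y _ h
  cases r with
  | nil => simp at h
  | cons b r =>
    refine ⟨r, ?_⟩
    obtain ⟨B, rfl⟩ : ∃ B', B = false :: B' := by
      cases B <;> simp_all
    rw [spacerJoin_append_cons, List.append_cancel_left_eq] at h
    cases a <;> cases b <;> cases r <;> simp at h <;> rfl

/-- The block `B` is recognizable after a `1`: in every word made of copies of `B` and spacers, an
occurrence of `1B` starts at a spacer. -/
def Recognizable (B : List Bool) : Prop :=
  ∀ t p q : List Bool, spacerJoin B t = p ++ true :: (B ++ q) →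
    ∃ t₁ t₂, t = t₁ ++ true :: t₂ ∧ p = spacerJoin B t₁

lemma recognizable_zero : Recognizable [false] := by
  intro t
  induction t with
  | nil => intro p q h; rcases p with _ | ⟨a, _ | ⟨b, p⟩⟩ <;> simp at h
  | cons b t ih =>
    intro p q h
    cases b
    · rcases p with _ | ⟨a, p⟩
      · simp at h
      · simp only [spacerJoin_cons, Bool.false_eq_true, if_false, List.nil_append,
          List.cons_append, List.cons.injEq] at h
        obtain ⟨rfl, h⟩ := h
        obtain ⟨t₁, t₂, rfl, rfl⟩ := ih p q h
        exact ⟨false :: t₁, t₂, by simp, by simp⟩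
    · rcases p with _ | ⟨a, _ | ⟨b, p⟩⟩
      · simp at h
      · simp only [spacerJoin_cons, if_true, List.nil_append,
          List.cons_append, List.cons.injEq] at h
        obtain ⟨rfl, -⟩ := h
        exact ⟨[], t, by simp, by simp⟩
      · simp only [spacerJoin_cons, if_true, List.nil_append,
          List.cons_append, List.cons.injEq] at h
        obtain ⟨rfl, rfl, h⟩ := h
        obtain ⟨t₁, t₂, rfl, rfl⟩ := ih p q h
        exact ⟨true :: t₁, t₂, by simp, by simp⟩

lemma spacerJoin_eq_append (B t : List Bool) : ∃ r, spacerJoin B t = B ++ r := ⟨_, rfl⟩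

lemma Recognizable.exists_suffix {B : List Bool} (hB : Recognizable B) {s p c r : List Bool}
    (h : spacerJoin B s = p ++ true :: (spacerJoin B c ++ r)) :
    ∃ s₁ s₂, s = s₁ ++ true :: s₂ ∧ p = spacerJoin B s₁ ∧
      spacerJoin B c ++ r = spacerJoin B s₂ := by
  obtain ⟨q, hq⟩ := spacerJoin_eq_append B c
  obtain ⟨s₁, s₂, rfl, rfl⟩ := hB s p (q ++ r) (by rw [h, hq, List.append_assoc])
  refine ⟨s₁, s₂, rfl, rfl, ?_⟩
  simpa using h.symm

/-- Recognizability passes from `B` to `((B1)^c B)^(l+2)`. -/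
lemma Recognizable.spacerJoin_spacerJoin {B : List Bool} (hB : Recognizable B)
    (hB0 : B.head? = some false) (c l : ℕ) :
    Recognizable (spacerJoin (spacerJoin B (List.replicate c true))
      (List.replicate (l + 1) false)) := by
  intro t p q h
  simp only [_root_.spacerJoin_spacerJoin] at h ⊢
  obtain ⟨s₁, s₂, hs, rfl, hs₂⟩ := hB.exists_suffix h
  obtain ⟨s₃, rfl⟩ := prefix_of_spacerJoin_append hB0 _ _ _ hs₂
  set f := List.replicate c true with hf
  set z := List.replicate (l + 1) false with hz
  rw [sepJoin_sepJoin] at hs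
  have hs' : sepJoin f (sepJoin z t) =
      (s₁ ++ true :: f) ++ false :: (sepJoin f (List.replicate l false) ++ s₃) := by
    rw [hs, hz, List.replicate_succ]; simp
  obtain ⟨g₁, g₂, hg, hg₁, -⟩ := exists_of_sepJoin_eq (by simp [hf]) _ _ _ hs'
  rcases List.eq_nil_or_concat g₁ with rfl | ⟨g₁, b, rfl⟩
  · have := congrArg List.length hg₁
    simp at this
    omega
  · rw [List.concat_eq_append, sepJoin_append_cons, sepJoin_nil] at hg₁
    obtain ⟨rfl, hb⟩ := List.append_inj' hg₁ rfl
    simp only [List.cons.injEq, and_true] at hb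
    subst hb
    rw [List.concat_eq_append, List.append_assoc] at hg
    obtain ⟨t₁, t₂, rfl, rfl, -⟩ := exists_of_sepJoin_eq (by simp [hz]) _ _ _ hg
    exact ⟨t₁, t₂, rfl, by rw [sepJoin_sepJoin]⟩

/-- Occurrences of `0B'`, where `B'` is made of copies of `u = (B1)^(c+1) B` with spacers `z`, are
aligned with the decomposition of the word into copies of `u`. -/
lemma Recognizable.exists_of_zero_append {B : List Bool} (hB : Recognizable B)
    (hB0 : B.head? = some false) (c : ℕ) {u z t p q : List Bool} {a : Bool}
    (hu : u = spacerJoin B (List.replicate (c + 1) true))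
    (h : spacerJoin (spacerJoin u z) t = p ++ false :: (spacerJoin u z ++ a :: q)) :
    ∃ g r, sepJoin z t = g ++ false :: (z ++ a :: r) ∧
      p ++ false :: spacerJoin u z = spacerJoin u (g ++ false :: z) := by
  set f := List.replicate (c + 1) true with hf
  obtain ⟨d, hd⟩ : ∃ d, sepJoin f z = true :: d := by
    rw [hf, List.replicate_succ]; exact ⟨_, rfl⟩
  subst hu
  have h' : spacerJoin B (sepJoin f (sepJoin z t)) =
      (p ++ false :: B) ++ true :: (spacerJoin B d ++ a :: q) := by
    rw [← sepJoin_sepJoin, ← _root_.spacerJoin_spacerJoin, ← _root_.spacerJoin_spacerJoin, h,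
      _root_.spacerJoin_spacerJoin, hd]
    simp
  obtain ⟨s₁, s₂, hs, hs₁, hs₂⟩ := hB.exists_suffix h'
  obtain ⟨s₃, rfl⟩ := exists_of_spacerJoin_append_cons hB0 hs₂
  rcases List.eq_nil_or_concat s₁ with rfl | ⟨s₁, b, rfl⟩
  · have := congrArg List.length hs₁
    simp at this
    omega
  rw [List.concat_eq_append, spacerJoin_append_cons, spacerJoin_nil, ← List.append_assoc] at hs₁
  replace hs₁ : (p ++ [false]) ++ B = spacerJoin B s₁ ++ (if b then [true] else []) ++ B := by
    simpa using hs₁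
  rw [List.append_cancel_right_eq] at hs₁
  cases b
  swap
  · exact absurd (List.append_inj' hs₁ rfl).2 (by simp)
  simp only [Bool.false_eq_true, if_false, List.append_nil] at hs₁
  replace hs : sepJoin f (sepJoin z t) = s₁ ++ false :: (sepJoin f z ++ a :: s₃) := by
    rw [hs, hd]; simp
  obtain ⟨g₁, g₂, hg, rfl, hg₂⟩ := exists_of_sepJoin_eq (by simp [hf]) _ _ _ hs
  obtain ⟨r, rfl⟩ := exists_of_sepJoin_append _ _ _ _ hg₂
  refine ⟨g₁, r, hg, ?_⟩
  rw [spacerJoin_append_cons, _root_.spacerJoin_spacerJoin, _root_.spacerJoin_spacerJoin, ← hs₁]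
  simp

/-- Words without two consecutive zeros. -/
def NoDoubleZero (t : List Bool) : Prop :=
  ∀ p q : List Bool, t ≠ p ++ false :: false :: q

lemma noDoubleZero_sepJoin (c : ℕ) (g : List Bool) :
    NoDoubleZero (sepJoin (List.replicate (c + 1) true) g) := by
  intro p q h
  obtain ⟨g₁, g₂, -, -, h₂⟩ := exists_of_sepJoin_eq (by simp) _ _ _ h
  simp [sepJoin, List.replicate_succ] at h₂

/-- A run of zeros followed by a `1`. -/
lemma suffix_of_sepJoin_eq_append_true {l : ℕ} {t g r : List Bool} (ht : NoDoubleZero t)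
    (h : sepJoin (List.replicate l false) t =
      g ++ false :: (List.replicate l false ++ true :: r)) :
    List.replicate (2 * l + 1) false <:+ g ++ false :: List.replicate l false := by
  have h' : sepJoin (List.replicate l false) t =
      (g ++ false :: List.replicate l false) ++ true :: r := by rw [h]; simp
  obtain ⟨t₁, t₂, rfl, h₁, -⟩ := exists_of_sepJoin_eq (by simp) _ _ _ h'
  rcases List.eq_nil_or_concat t₁ with rfl | ⟨t₁, b, rfl⟩
  · have := congrArg List.length h₁
    simp at this
    omega
  have hz : ∀ x, List.replicate (2 * l + 1) false <:+
      (x ++ List.replicate l false) ++ false :: List.replicate l false := by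
    intro x
    refine ⟨x, ?_⟩
    rw [List.append_assoc, ← List.replicate_succ, ← List.replicate_add]
    congr 2; omega
  rw [List.concat_eq_append, sepJoin_append_cons, sepJoin_nil] at h₁
  have hb := (List.append_inj' h₁ rfl).2
  simp only [List.cons.injEq, and_true] at hb
  subst hb
  rw [h₁]
  rcases List.eq_nil_or_concat t₁ with rfl | ⟨t₁, b, rfl⟩
  · simpa using hz []
  · rw [List.concat_eq_append, sepJoin_append_cons, sepJoin_nil]
    have := hz (sepJoin (List.replicate l false) t₁ ++ [b])
    simpa using this

lemma le_of_sepJoin_eq_replicate_append {l j : ℕ} {t r : List Bool} (ht : NoDoubleZero t)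
    (h : sepJoin (List.replicate l false) t = List.replicate j false ++ r) : j ≤ 2 * l + 1 := by
  by_contra! hj
  have key : ∀ i, i < j → (sepJoin (List.replicate l false) t)[i]? = some false := by
    intro i hi
    rw [h, List.getElem?_append_left (by simpa using hi)]
    simp [hi]
  rcases t with _ | ⟨_ | _, _ | ⟨_ | _, t⟩⟩
  · have := key l (by omega); simp at this
  · have := key (2 * l + 1) (by omega)
    rw [List.getElem?_eq_none (by simp; omega)] at this
    simp at this
  · exact ht [] t rfl
  · have := key (2 * l + 1) (by omega)
    rw [sepJoin_cons, sepJoin_cons, List.getElem?_append_right (by simp; omega),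
      List.getElem?_cons, if_neg (by simp; omega),
      List.getElem?_append_right (by simp; omega)] at this
    have e : 2 * l + 1 - (List.replicate l false).length - 1 -
      (List.replicate l false).length = 0 := by simp; omega
    rw [e] at this
    simp at this
  all_goals
    have := key l (by omega)
    simp at this

lemma eq_replicate_or_exists (h : List Bool) :
    ∃ j, h = List.replicate j false ∨ ∃ x, h = x ++ true :: List.replicate j false := by
  induction h with
  | nil => exact ⟨0, Or.inl rfl⟩
  | cons b h ih =>
    obtain ⟨j, rfl | ⟨x, rfl⟩⟩ := ih
    · cases b
      · exact ⟨j + 1, Or.inl rfl⟩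
      · exact ⟨j, Or.inr ⟨[], rfl⟩⟩
    · exact ⟨j, Or.inr ⟨b :: x, rfl⟩⟩

/-- A run of zeros followed by a `0`. -/
lemma exists_of_sepJoin_eq_append_false {l : ℕ} {t h r : List Bool} (ht : NoDoubleZero t)
    (hh : sepJoin (List.replicate l false) t = h ++ false :: r) :
    ∃ j ≤ 2 * l, h = List.replicate j false ∨ ∃ x, h = x ++ true :: List.replicate j false := by
  obtain ⟨j, hj⟩ := eq_replicate_or_exists h
  refine ⟨j, ?_, hj⟩
  rcases hj with rfl | ⟨x, rfl⟩
  · have := le_of_sepJoin_eq_replicate_append (j := j + 1) (r := r) ht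
      (by rw [hh, List.replicate_succ']; simp)
    omega
  · rw [List.append_assoc, List.cons_append] at hh
    obtain ⟨t₁, t₂, rfl, -, h₂⟩ := exists_of_sepJoin_eq (by simp) _ _ _ hh
    have ht₂ : NoDoubleZero t₂ := fun p q e => ht (t₁ ++ true :: p) q (by rw [e]; simp)
    have := le_of_sepJoin_eq_replicate_append (j := j + 1) (r := r) ht₂
      (by rw [← h₂, List.replicate_succ']; simp)
    omega

lemma spacerJoin_replicate_true (B : List Bool) (c : ℕ) :
    spacerJoin B (List.replicate c true) =
      (List.replicate c (B ++ [true])).flatten ++ B := by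
  induction c with
  | zero => simp
  | succ c ih => simp [List.replicate_succ, ih]

lemma spacerJoin_replicate_false (u : List Bool) (k : ℕ) :
    spacerJoin u (List.replicate k false) = (List.replicate (k + 1) u).flatten := by
  induction k with
  | zero => simp
  | succ k ih =>
    rw [List.replicate_succ, spacerJoin_cons, ih, List.replicate_succ (n := k + 1)]
    simp

lemma Cseq_succ {L γ : ℕ → ℕ} {m : ℕ} (hm : 1 ≤ m) (hL : 1 ≤ L m) :
    Cseq L γ (m + 1) = spacerJoin (spacerJoin (Cseq L γ m) (List.replicate (γ m) true))
      (List.replicate (L m - 1) false) := by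
  obtain ⟨m, rfl⟩ := Nat.exists_eq_add_of_le' hm
  rw [spacerJoin_replicate_false, spacerJoin_replicate_true, Nat.sub_add_cancel hL, Cseq]

lemma head?_spacerJoin {B : List Bool} (hB : B.head? = some false) (t : List Bool) :
    (spacerJoin B t).head? = some false := by
  cases B <;> simp_all [spacerJoin]

lemma getLast?_spacerJoin {B : List Bool} (hB : B.getLast? = some false) (t : List Bool) :
    (spacerJoin B t).getLast? = some false := by
  induction t with
  | nil => simpa
  | cons b t ih => rw [spacerJoin_cons]; simp [List.getLast?_append, ih]

section

variable {L γ : ℕ → ℕ}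

lemma head?_Cseq (hL : ∀ n, 1 ≤ n → 2 ≤ L n) {n : ℕ} (hn : 1 ≤ n) :
    (Cseq L γ n).head? = some false := by
  induction n, hn using Nat.le_induction with
  | base => rfl
  | succ n hn ih =>
    rw [Cseq_succ hn (by have := hL n hn; omega)]
    exact head?_spacerJoin (head?_spacerJoin ih _) _

lemma getLast?_Cseq (hL : ∀ n, 1 ≤ n → 2 ≤ L n) {n : ℕ} (hn : 1 ≤ n) :
    (Cseq L γ n).getLast? = some false := by
  induction n, hn using Nat.le_induction with
  | base => rfl
  | succ n hn ih =>
    rw [Cseq_succ hn (by have := hL n hn; omega)]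
    exact getLast?_spacerJoin (getLast?_spacerJoin ih _) _

lemma recognizable_Cseq (hL : ∀ n, 1 ≤ n → 2 ≤ L n) {n : ℕ} (hn : 1 ≤ n) :
    Recognizable (Cseq L γ n) := by
  induction n, hn using Nat.le_induction with
  | base => exact recognizable_zero
  | succ n hn ih =>
    have h2 := hL n hn
    rw [Cseq_succ hn (by omega), show L n - 1 = (L n - 2) + 1 by omega]
    exact ih.spacerJoin_spacerJoin (head?_Cseq hL hn) _ _

lemma Cseq_infix_succ (hL : ∀ n, 1 ≤ n → 2 ≤ L n) (k : ℕ) :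
    Cseq L γ k <:+: Cseq L γ (k + 1) := by
  rcases Nat.eq_zero_or_pos k with rfl | hk
  · exact List.infix_rfl
  · rw [Cseq_succ hk (by have := hL k hk; omega), spacerJoin_spacerJoin]
    exact List.IsPrefix.isInfix ⟨_, rfl⟩

lemma Cseq_infix_add (hL : ∀ n, 1 ≤ n → 2 ≤ L n) (k d : ℕ) :
    Cseq L γ k <:+: Cseq L γ (k + d) := by
  induction d with
  | zero => exact List.infix_rfl
  | succ d ih => exact ih.trans (Cseq_infix_succ hL _)

lemma exists_Cseq_eq_spacerJoin (hL : ∀ n, 1 ≤ n → 2 ≤ L n) (hγ : ∀ n, 1 ≤ n → 2 ≤ γ n)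
    (d : ℕ) : ∀ n, 1 ≤ n → ∃ t, NoDoubleZero t ∧ Cseq L γ (n + d) = spacerJoin (Cseq L γ n) t := by
  induction d with
  | zero => exact fun n _ => ⟨[], fun p q h => by simp at h, by simp⟩
  | succ d ih =>
    intro n hn
    obtain ⟨t, -, h⟩ := ih (n + 1) (by omega)
    have h2 := hL n hn
    have h3 := hγ n hn
    rw [Cseq_succ hn (by omega), spacerJoin_spacerJoin, spacerJoin_spacerJoin] at h
    refine ⟨_, ?_, by rw [← h]; congr 1; omega⟩
    rw [show γ n = (γ n - 1) + 1 by omega]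
    exact noDoubleZero_sepJoin _ _

lemma InLangC.exists_spacerJoin (hL : ∀ n, 1 ≤ n → 2 ≤ L n) (hγ : ∀ n, 1 ≤ n → 2 ≤ γ n)
    {n : ℕ} (hn : 1 ≤ n) {w : List Bool} (hw : InLangC L γ w) :
    ∃ t p q, NoDoubleZero t ∧ spacerJoin (Cseq L γ n) t = p ++ w ++ q := by
  obtain ⟨k, hk⟩ := hw
  obtain ⟨t, ht, h⟩ := exists_Cseq_eq_spacerJoin hL hγ k n hn
  obtain ⟨p, q, hpq⟩ := hk.trans (Cseq_infix_add hL k n)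
  exact ⟨t, p, q, ht, by rw [hpq, ← h, Nat.add_comm]⟩

end

/-- If spacers equal to `0` are isolated, then `000` does not occur. -/
lemma spacerJoin_zero_ne (t : List Bool) : NoDoubleZero t → ∀ p q : List Bool,
    spacerJoin [false] t ≠ p ++ false :: false :: false :: q := by
  induction t with
  | nil => intro _ p q h; rcases p with _ | ⟨a, p⟩ <;> simp at h
  | cons b t ih =>
    intro ht p q h
    have ht' : NoDoubleZero t := fun p q e => ht (b :: p) q (by rw [e]; simp)
    cases b
    · rcases p with _ | ⟨a, p⟩
      · rcases t with _ | ⟨_ | _, t⟩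
        · simp at h
        · exact ht [] t rfl
        · simp at h
      · simp only [spacerJoin_cons, Bool.false_eq_true, if_false, List.nil_append,
          List.cons_append, List.cons.injEq] at h
        exact ih ht' p q h.2
    · rcases p with _ | ⟨a, _ | ⟨b, p⟩⟩
      · simp at h
      · simp at h
      · simp only [spacerJoin_cons, if_true, List.nil_append,
          List.cons_append, List.cons.injEq] at h
        exact ih ht' p q h.2.2

lemma suffix_spacerJoin_of_suffix (u : List Bool) {s t : List Bool} (h : s <:+ t) :
    spacerJoin u s <:+ spacerJoin u t := by
  obtain ⟨x, rfl⟩ := h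
  rcases List.eq_nil_or_concat x with rfl | ⟨x, b, rfl⟩
  · simp
  · refine ⟨spacerJoin u x ++ (if b then [true] else []), ?_⟩
    rw [List.concat_eq_append, List.append_assoc x, List.singleton_append, spacerJoin_append_cons]
    simp

lemma suffix_spacerJoin_replicate {u : List Bool} (hu : u.getLast? = some false)
    {w h₀ h₁ : List Bool} {l j : ℕ} (hj : j ≤ l)
    (hh₀ : h₀ = List.replicate j false ∨ ∃ x, h₀ = x ++ true :: List.replicate j false)
    (hh₁ : List.replicate (l + 1) false <:+ h₁)
    (hw₀ : w <:+ spacerJoin u h₀) (hw₁ : w <:+ spacerJoin u h₁) :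
    w <:+ spacerJoin u (List.replicate l false) := by
  have hmono : ∀ i k, i ≤ k → spacerJoin u (List.replicate i false) <:+
      spacerJoin u (List.replicate k false) := fun i k hik =>
    suffix_spacerJoin_of_suffix u ⟨List.replicate (k - i) false, by
      rw [← List.replicate_add]; congr 1; omega⟩
  rcases hh₀ with rfl | ⟨x, rfl⟩
  · exact hw₀.trans (hmono j l hj)
  rw [spacerJoin_append_cons] at hw₀
  have hv : spacerJoin u (List.replicate j false) <:+ spacerJoin u x ++
      ((if true then [true] else []) ++ spacerJoin u (List.replicate j false)) :=
    ⟨spacerJoin u x ++ [true], by simp⟩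
  rcases List.suffix_or_suffix_of_suffix hw₀ hv with h | h
  · exact h.trans (hmono j l hj)
  by_cases hlen : w.length ≤ (spacerJoin u (List.replicate j false)).length
  · exact (List.suffix_of_suffix_length_le hw₀ hv hlen).trans (hmono j l hj)
  have h1 : true :: spacerJoin u (List.replicate j false) <:+ w :=
    List.suffix_of_suffix_length_le ⟨spacerJoin u x, by simp⟩ hw₀ (by simp; omega)
  have h0 : false :: spacerJoin u (List.replicate j false) <:+ spacerJoin u h₁ := by
    refine List.IsSuffix.trans ?_
      ((hmono (j + 1) (l + 1) (by omega)).trans (suffix_spacerJoin_of_suffix u hh₁))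
    rcases List.eq_nil_or_concat u with rfl | ⟨v, b, rfl⟩
    · simp at hu
    · simp only [List.concat_eq_append, List.getLast?_append, List.getLast?_singleton,
        Option.some_or, Option.some.injEq] at hu
      subst hu
      exact ⟨v, by rw [List.replicate_succ, spacerJoin_cons]; simp⟩
  have := List.suffix_of_suffix_length_le (h1.trans hw₁) h0 (by simp)
  have := this.eq_of_length (by simp)
  simp at this

/-- If `w` is right-special and has `0 B_n` as a suffix, then `n > 1` and `w` is a
suffix of `((B_{n-1} 1)^{γ_{n-1}} B_{n-1})^{L_{n-1} - 1} B_n`. -/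
theorem stmt14 (L γ : ℕ → ℕ) (hL : ∀ n, 1 ≤ n → 2 ≤ L n) (hγ : ∀ n, 1 ≤ n → 2 ≤ γ n)
    (n : ℕ) (hn : 1 ≤ n) (w : List Bool) (hrs : RightSpecialC L γ w)
    (hsuf : (false :: Cseq L γ n) <:+ w) :
    1 < n ∧
      w <:+ ((List.replicate (L (n - 1) - 1)
          ((List.replicate (γ (n - 1)) (Cseq L γ (n - 1) ++ [true])).flatten ++
            Cseq L γ (n - 1))).flatten ++ Cseq L γ n) := by
  obtain ⟨w', rfl⟩ := hsuf
  obtain ⟨t₀, p₀, q₀, ht₀, e₀⟩ := InLangC.exists_spacerJoin hL hγ hn hrs.1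
  obtain ⟨t₁, p₁, q₁, ht₁, e₁⟩ := InLangC.exists_spacerJoin hL hγ hn hrs.2
  rcases Nat.lt_or_ge 1 n with hn1 | hn1
  swap
  · obtain rfl : n = 1 := by omega
    exact absurd (e₀.trans (by simp [Cseq])) (spacerJoin_zero_ne t₀ ht₀ (p₀ ++ w') q₀)
  refine ⟨hn1, ?_⟩
  obtain ⟨m, rfl⟩ : ∃ m, n = m + 1 := ⟨n - 1, by omega⟩
  have hm : 1 ≤ m := by omega
  have hLm := hL m hm
  have hγm := hγ m hm
  have hc : γ m = (γ m - 1) + 1 := by omega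
  have hB0 := head?_Cseq (γ := γ) hL hm
  have hR := recognizable_Cseq (γ := γ) hL hm
  obtain ⟨u, hu⟩ : ∃ u, u = spacerJoin (Cseq L γ m) (List.replicate (γ m) true) := ⟨_, rfl⟩
  have hu0 : u.getLast? = some false := by
    rw [hu]; exact getLast?_spacerJoin (getLast?_Cseq hL hm) _
  have hC := Cseq_succ (γ := γ) hm (show 1 ≤ L m by omega)
  rw [← hu] at hC
  have htarget : (List.replicate (L m - 1) u).flatten ++ Cseq L γ (m + 1) =
      spacerJoin u (List.replicate (2 * (L m - 1)) false) := by
    rw [hC, spacerJoin_replicate_false, spacerJoin_replicate_false, ← List.flatten_append,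
      ← List.replicate_add]
    congr 2; omega
  rw [Nat.add_sub_cancel, ← spacerJoin_replicate_true, ← hu, htarget]
  rw [hC] at e₀ e₁ ⊢
  rw [hc] at hu
  obtain ⟨g₀, r₀, hg₀, hw₀⟩ := hR.exists_of_zero_append hB0 _ (p := p₀ ++ w') (q := q₀)
    (a := false) hu (by rw [e₀]; simp)
  obtain ⟨g₁, r₁, hg₁, hw₁⟩ := hR.exists_of_zero_append hB0 _ (p := p₁ ++ w') (q := q₁)
    (a := true) hu (by rw [e₁]; simp)
  obtain ⟨j, hj, hh₀⟩ := exists_of_sepJoin_eq_append_false ht₀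
    (h := g₀ ++ false :: List.replicate (L m - 1) false) (r := r₀) (by rw [hg₀]; simp)
  exact suffix_spacerJoin_replicate hu0 hj hh₀ (suffix_of_sepJoin_eq_append_true ht₁ hg₁)
    ⟨p₀, by rw [← hw₀]; simp⟩ ⟨p₁, by rw [← hw₁]; simp⟩
end

section
/- Let w be a right-special word with len(w) > 1. Then there exists a unique n >= 1 such that exactly one of the following holds (and for m different from n, none of the three holds with m in place of n): (i) w is a suffix of B_{n+1} and h_n < len(w) <= h_{n+1}; (ii) w is a suffix of (B_n 1)^{2 gamma_n} B_n and (gamma_n + 1) h_n + gamma_n < len(w) <= (2 gamma_n + 1) h_n + 2 gamma_n; (iii) n > 1, w is a suffix of ((B_{n-1} 1)^{gamma_{n-1}} B_{n-1})^{L_{n-1} - 1} B_n, and h_n < len(w) <= (2 - 1/L_{n-1}) h_n. In all three cases h_n < len(w) <= h_{n+1}. -/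
/-- Case (i): `w` is a suffix of `B_{n+1}` and `h_n < len(w) ≤ h_{n+1}`. -/
def Case1 (L γ : ℕ → ℕ) (w : List Bool) (n : ℕ) : Prop :=
  w <:+ Cseq L γ (n + 1) ∧
    (Cseq L γ n).length < w.length ∧ w.length ≤ (Cseq L γ (n + 1)).length

/-- Case (ii): `w` is a suffix of `(B_n 1)^{2 γ_n} B_n` and
`(γ_n + 1) h_n + γ_n < len(w) ≤ (2 γ_n + 1) h_n + 2 γ_n`. -/
def Case2 (L γ : ℕ → ℕ) (w : List Bool) (n : ℕ) : Prop :=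
  w <:+ ((List.replicate (2 * γ n) (Cseq L γ n ++ [true])).flatten ++ Cseq L γ n) ∧
    (γ n + 1) * (Cseq L γ n).length + γ n < w.length ∧
    w.length ≤ (2 * γ n + 1) * (Cseq L γ n).length + 2 * γ n

/-- Case (iii): `n > 1`, `w` is a suffix of `((B_{n-1} 1)^{γ_{n-1}} B_{n-1})^{L_{n-1}-1} B_n`
and `h_n < len(w) ≤ (2 - 1/L_{n-1}) h_n`. -/
def Case3 (L γ : ℕ → ℕ) (w : List Bool) (n : ℕ) : Prop :=
  1 < n ∧
    w <:+ ((List.replicate (L (n - 1) - 1)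
        ((List.replicate (γ (n - 1)) (Cseq L γ (n - 1) ++ [true])).flatten ++
          Cseq L γ (n - 1))).flatten ++ Cseq L γ n) ∧
    (Cseq L γ n).length < w.length ∧
    (w.length : ℝ) ≤ (2 - 1 / (L (n - 1) : ℝ)) * ((Cseq L γ n).length : ℝ)

/-- The substitution `0 ↦ 0^l`, `1 ↦ 1`. -/
def runSubst (l : ℕ) : Bool → List Bool
  | false => List.replicate l false
  | true => [true]

/-- The substitution `0 ↦ (01)^g 0`, `1 ↦ 1`. -/
def altSubst (g : ℕ) : Bool → List Bool
  | false => (List.replicate g [false, true]).flatten ++ [false]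
  | true => [true]

theorem List.IsSuffix.append_same {α : Type*} {u v : List α} (h : u <:+ v) (w : List α) :
    u ++ w <:+ v ++ w := by
  obtain ⟨t, rfl⟩ := h
  exact ⟨t, by simp⟩

section Desubstitution

variable {f : Bool → List Bool}

theorem exists_cut_of_append_eq_flatMap {Z a v : List Bool} (h : a ++ v = Z.flatMap f)
    (hv : v ≠ []) :
    ∃ Z₁ c Z₂ a', Z = Z₁ ++ c :: Z₂ ∧ a = Z₁.flatMap f ++ a' ∧
      a' ++ v = f c ++ Z₂.flatMap f ∧ a'.length < (f c).length := by
  induction Z generalizing a with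
  | nil => simp_all
  | cons c Z ih =>
    by_cases hlt : a.length < (f c).length
    · exact ⟨[], c, Z, a, rfl, rfl, by simpa using h, hlt⟩
    · have hpre : f c <+: a := List.prefix_of_prefix_length_le
        (l₃ := a ++ v) (by rw [h, List.flatMap_cons]; exact List.prefix_append _ _)
        (List.prefix_append _ _) (by omega)
      obtain ⟨a₁, rfl⟩ := hpre
      rw [List.flatMap_cons, List.append_assoc, List.append_cancel_left_eq] at h
      obtain ⟨Z₁, d, Z₂, a', rfl, rfl, h₁, h₂⟩ := ih h
      exact ⟨c :: Z₁, d, Z₂, a', rfl, by simp, h₁, h₂⟩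

theorem head_eq_of_flatMap_eq_cons (hf : ∀ a, [a] <+: f a) {Z b : List Bool} {c : Bool}
    (h : Z.flatMap f = c :: b) : ∃ Z', Z = c :: Z' := by
  cases Z with
  | nil => simp at h
  | cons d Z =>
    obtain ⟨t, ht⟩ := hf d
    rw [List.flatMap_cons, ← ht] at h
    simp only [List.cons_append, List.cons.injEq] at h
    exact ⟨Z, by rw [h.1]⟩

theorem last_eq_of_flatMap_eq_concat (hf : ∀ a, [a] <:+ f a) {Z b : List Bool} {c : Bool}
    (h : Z.flatMap f = b ++ [c]) : ∃ Z', Z = Z' ++ [c] := by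
  induction Z using List.reverseRecOn with
  | nil => simp at h
  | append_singleton Z d _ =>
    obtain ⟨t, ht⟩ := hf d
    rw [List.flatMap_append, List.flatMap_singleton, ← ht, ← List.append_assoc] at h
    obtain ⟨-, h⟩ := List.append_inj' h rfl
    exact ⟨Z, by rw [h]⟩

/-- If `t0` and `t1` are both prefixes of images under a substitution `f` such that every `f a`
starts with `a`, then `t` is itself an image. -/
theorem exists_common_prefix_of_flatMap (hf : ∀ a, [a] <+: f a) {Z Z' t b b' : List Bool}
    (h : Z.flatMap f = t ++ false :: b) (h' : Z'.flatMap f = t ++ true :: b') :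
    ∃ x, x ++ [false] <+: Z ∧ x ++ [true] <+: Z' ∧ t = x.flatMap f := by
  induction Z generalizing Z' t with
  | nil => simp at h
  | cons c Z ih =>
    rcases t with _ | ⟨d, t⟩
    · obtain ⟨Y, hY⟩ := head_eq_of_flatMap_eq_cons hf h
      obtain ⟨Y', rfl⟩ := head_eq_of_flatMap_eq_cons hf h'
      exact ⟨[], by simp [hY], by simp, rfl⟩
    · obtain ⟨Y, hY⟩ := head_eq_of_flatMap_eq_cons hf h
      obtain ⟨Y', rfl⟩ := head_eq_of_flatMap_eq_cons hf h'
      obtain ⟨rfl, rfl⟩ := List.cons.inj hY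
      by_cases hlt : (f c).length ≤ (c :: t).length
      · obtain ⟨t', ht'⟩ : f c <+: c :: t := List.prefix_of_prefix_length_le
          (l₃ := (c :: t) ++ false :: b) (by rw [← h, List.flatMap_cons]; simp)
          (List.prefix_append _ _) hlt
        rw [← ht', List.flatMap_cons, List.append_assoc, List.append_cancel_left_eq] at h h'
        obtain ⟨x, h₁, h₂, h₃⟩ := ih h h'
        exact ⟨c :: x, by simpa using h₁, by simpa using h₂, by
          rw [← ht', h₃, List.flatMap_cons]⟩
      · have h₁ : (c :: t) ++ [false] <+: f c := List.prefix_of_prefix_length_le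
          (l₃ := (c :: t) ++ false :: b) (by simp) (by rw [← h, List.flatMap_cons]; simp)
          (by simp at hlt ⊢; omega)
        have h₂ : (c :: t) ++ [true] <+: f c := List.prefix_of_prefix_length_le
          (l₃ := (c :: t) ++ true :: b') (by simp) (by rw [← h', List.flatMap_cons]; simp)
          (by simp at hlt ⊢; omega)
        have h₃ := List.prefix_of_prefix_length_le h₁ h₂ (by simp)
        simp at h₃

theorem exists_common_suffix_of_flatMap (hf : ∀ a, [a] <:+ f a) {Z Z' s a a' : List Bool}
    (h : Z.flatMap f = a ++ s) (h' : Z'.flatMap f = a' ++ s) :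
    ∃ y, y <:+ Z ∧ y <:+ Z' ∧ s <:+ y.flatMap f := by
  induction Z using List.reverseRecOn generalizing Z' s with
  | nil => exact ⟨[], by simp, by simp, by simp_all⟩
  | append_singleton Z c ih =>
    rcases List.eq_nil_or_concat s with rfl | ⟨s, d, rfl⟩
    · exact ⟨[], by simp, by simp, by simp⟩
    · rw [List.concat_eq_append] at h h' ⊢
      obtain ⟨Y, hY⟩ := last_eq_of_flatMap_eq_concat hf (h.trans (List.append_assoc _ _ _).symm)
      obtain ⟨Y', rfl⟩ := last_eq_of_flatMap_eq_concat hf (h'.trans (List.append_assoc _ _ _).symm)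
      obtain ⟨rfl, hcd⟩ := List.append_inj' hY rfl
      obtain rfl : c = d := by simpa using hcd
      rw [List.flatMap_append, List.flatMap_singleton] at h h'
      by_cases hlt : (f c).length ≤ (s ++ [c]).length
      · obtain ⟨t', ht'⟩ : f c <:+ s ++ [c] := List.suffix_of_suffix_length_le
          (l₃ := a ++ (s ++ [c])) (by rw [← h]; exact List.suffix_append _ _)
          (List.suffix_append _ _) hlt
        rw [← ht', ← List.append_assoc, List.append_cancel_right_eq] at h h'
        obtain ⟨y, h₁, h₂, h₃⟩ := ih h h'
        refine ⟨y ++ [c], ?_, ?_, ?_⟩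
        · exact h₁.append_same _
        · exact h₂.append_same _
        · rw [← ht', List.flatMap_append, List.flatMap_singleton]
          exact h₃.append_same _
      · refine ⟨[c], List.suffix_append _ _, List.suffix_append _ _, ?_⟩
        rw [List.flatMap_singleton]
        exact List.suffix_of_suffix_length_le (l₃ := a ++ (s ++ [c]))
          (List.suffix_append _ _) (by rw [← h]; exact List.suffix_append _ _) (by omega)

/-- Desubstitution of a right-special word `st` whose cut between `s` and `t` always falls on a
boundary between images of letters. -/
theorem exists_desubstitution (hf : ∀ a, [a] <+: f a) (hf' : ∀ a, [a] <:+ f a)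
    {Z s t : List Bool}
    (hcut : ∀ a b, a ++ s ++ (t ++ b) = Z.flatMap f →
      ∃ Z₁ Z₂, Z = Z₁ ++ Z₂ ∧ Z₁.flatMap f = a ++ s ∧ Z₂.flatMap f = t ++ b)
    (h0 : s ++ t ++ [false] <:+: Z.flatMap f) (h1 : s ++ t ++ [true] <:+: Z.flatMap f) :
    ∃ u, u ++ [false] <:+: Z ∧ u ++ [true] <:+: Z ∧ s ++ t <:+ u.flatMap f := by
  obtain ⟨a, b, h0⟩ := h0
  obtain ⟨a', b', h1⟩ := h1
  obtain ⟨Z₁, Z₂, hZ, hZ₁, hZ₂⟩ := hcut a (false :: b) (by rw [← h0]; simp)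
  obtain ⟨Y₁, Y₂, hY, hY₁, hY₂⟩ := hcut a' (true :: b') (by rw [← h1]; simp)
  obtain ⟨x, hx, hx', rfl⟩ := exists_common_prefix_of_flatMap hf hZ₂ hY₂
  obtain ⟨y, hy, hy', hs⟩ := exists_common_suffix_of_flatMap hf' hZ₁ hY₁
  refine ⟨y ++ x, ?_, ?_, ?_⟩
  · obtain ⟨p, rfl⟩ := hy
    obtain ⟨q, rfl⟩ := hx
    exact ⟨p, q, by rw [hZ]; simp⟩
  · obtain ⟨p, rfl⟩ := hy'
    obtain ⟨q, rfl⟩ := hx'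
    exact ⟨p, q, by rw [hY]; simp⟩
  · rw [List.flatMap_append]
    exact hs.append_same _

end Desubstitution

theorem prefix_runSubst (l : ℕ) (hl : 1 ≤ l) (a : Bool) : [a] <+: runSubst l a := by
  cases a with
  | true => exact List.prefix_rfl
  | false =>
    obtain ⟨k, rfl⟩ := Nat.exists_eq_add_of_le' hl
    exact ⟨List.replicate k false, by simp [runSubst, List.replicate_succ]⟩

theorem suffix_runSubst (l : ℕ) (hl : 1 ≤ l) (a : Bool) : [a] <:+ runSubst l a := by
  cases a with
  | true => exact List.suffix_rfl
  | false =>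
    obtain ⟨k, rfl⟩ := Nat.exists_eq_add_of_le' hl
    exact ⟨List.replicate k false, by simp [runSubst, List.replicate_succ']⟩

theorem prefix_altSubst (g : ℕ) (a : Bool) : [a] <+: altSubst g a := by
  cases a with
  | true => exact List.prefix_rfl
  | false => cases g <;> simp [altSubst, List.replicate_succ]

theorem suffix_altSubst (g : ℕ) (a : Bool) : [a] <:+ altSubst g a := by
  cases a with
  | true => exact List.suffix_rfl
  | false => exact List.suffix_append _ _

theorem runSubst_cut {l : ℕ} {Z a r : List Bool}
    (h : a ++ true :: r = Z.flatMap (runSubst l)) :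
    ∃ Z₁ Z₂, Z = Z₁ ++ true :: Z₂ ∧ Z₁.flatMap (runSubst l) = a ∧
      Z₂.flatMap (runSubst l) = r := by
  obtain ⟨Z₁, c, Z₂, a', rfl, rfl, h₁, h₂⟩ := exists_cut_of_append_eq_flatMap h (by simp)
  cases c with
  | true =>
    obtain rfl : a' = [] := by simpa [runSubst] using h₂
    exact ⟨Z₁, Z₂, rfl, by simp, by simpa [runSubst] using h₁.symm⟩
  | false =>
    have h₃ : a' ++ [true] <+: runSubst l false := List.prefix_of_prefix_length_le
      (l₃ := a' ++ true :: r) (by simp) (by rw [h₁]; exact List.prefix_append _ _)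
      (by simpa using h₂)
    have := h₃.subset (a := true) (by simp)
    simp [runSubst] at this

theorem not_infix_one_one_runSubst {l : ℕ} (hl : 1 ≤ l) {Z : List Bool}
    (hZ : ¬ [true, true] <:+: Z) : ¬ [true, true] <:+: Z.flatMap (runSubst l) := by
  rintro ⟨a, b, h⟩
  obtain ⟨Z₁, Z₂, rfl, -, h⟩ := runSubst_cut (r := true :: b) (by simpa using h)
  obtain ⟨Z₃, rfl⟩ := head_eq_of_flatMap_eq_cons (prefix_runSubst l hl) h
  exact hZ ⟨Z₁, Z₃, by simp⟩

theorem not_infix_one_zero_one_runSubst {l : ℕ} (hl : 2 ≤ l) {Z : List Bool} :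
    ¬ [true, false, true] <:+: Z.flatMap (runSubst l) := by
  rintro ⟨a, b, h⟩
  obtain ⟨Z₁, Z₂, rfl, -, h⟩ := runSubst_cut (r := false :: true :: b) (by simpa using h)
  obtain ⟨Z₃, rfl⟩ := head_eq_of_flatMap_eq_cons (prefix_runSubst l (by omega)) h
  obtain ⟨k, rfl⟩ := Nat.exists_eq_add_of_le' hl
  simp [runSubst, List.replicate_succ] at h

theorem flatMap_runSubst_eq_replicate_append {l : ℕ} (hl : 1 ≤ l) {Z b : List Bool} {m : ℕ}
    (hm : l < m) (h : Z.flatMap (runSubst l) = List.replicate m false ++ b) :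
    ∃ Z', Z = false :: Z' ∧ Z'.flatMap (runSubst l) = List.replicate (m - l) false ++ b := by
  obtain ⟨k, rfl⟩ := Nat.exists_eq_add_of_lt hm
  obtain ⟨Z', rfl⟩ := head_eq_of_flatMap_eq_cons (prefix_runSubst l hl)
    (h.trans (by rw [List.replicate_succ, List.cons_append]))
  refine ⟨Z', rfl, ?_⟩
  rw [List.flatMap_cons, add_assoc, List.replicate_add, List.append_assoc] at h
  rw [add_assoc, Nat.add_sub_cancel_left]
  exact List.append_cancel_left h

theorem not_infix_replicate_runSubst {l : ℕ} (hl : 1 ≤ l) {Z : List Bool}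
    (hZ : ¬ [false, false, false] <:+: Z) :
    ¬ List.replicate (2 * l + 1) false <:+: Z.flatMap (runSubst l) := by
  rintro ⟨a, b, h⟩
  rw [List.append_assoc] at h
  obtain ⟨Z₁, c, Z₂, a', rfl, -, h₁, h₂⟩ := exists_cut_of_append_eq_flatMap h
    (by simp [List.replicate_succ])
  cases c with
  | true =>
    obtain rfl : a' = [] := by simpa [runSubst] using h₂
    simp [runSubst, List.replicate_succ] at h₁
  | false =>
    have ha' : a' = List.replicate a'.length false := by
      have h₃ : a' <+: List.replicate l false := List.prefix_of_prefix_length_le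
        (l₃ := a' ++ (List.replicate (2 * l + 1) false ++ b)) (by simp)
        (by rw [h₁]; exact List.prefix_append _ _) h₂.le
      exact List.eq_replicate_of_mem fun x hx => List.eq_of_mem_replicate (h₃.subset hx)
    rw [ha', ← List.append_assoc, List.replicate_append_replicate, ← List.flatMap_cons] at h₁
    obtain ⟨Y, hY, h₃⟩ := flatMap_runSubst_eq_replicate_append hl (by omega) h₁.symm
    obtain ⟨Y', rfl, h₄⟩ := flatMap_runSubst_eq_replicate_append hl (by omega) h₃
    obtain ⟨Y'', rfl⟩ := head_eq_of_flatMap_eq_cons (prefix_runSubst l hl)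
      (b := List.replicate (a'.length + (2 * l + 1) - l - l - 1) false ++ b) (c := false) (by
        rw [h₄, ← List.cons_append, ← List.replicate_succ]
        congr 2
        omega)
    exact hZ ⟨Z₁, Y'', by rw [hY]; simp⟩

theorem runSubst_rightSpecial {l : ℕ} (hl : 1 ≤ l) {Z w : List Bool}
    (h11 : ¬ [true, true] <:+: Z) (h000 : ¬ [false, false, false] <:+: Z)
    (h0 : w ++ [false] <:+: Z.flatMap (runSubst l))
    (h1 : w ++ [true] <:+: Z.flatMap (runSubst l)) :
    w <:+ List.replicate (2 * l - 1) false ∨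
      ∃ u, u ++ [false] <:+: Z ∧ u ++ [true] <:+: Z ∧ w <:+ u.flatMap (runSubst l) := by
  by_cases hw : true ∈ w
  · right
    obtain ⟨s, t, rfl⟩ := List.append_of_mem hw
    refine exists_desubstitution (prefix_runSubst l hl) (suffix_runSubst l hl) ?_ h0 h1
    intro a b h
    obtain ⟨Z₁, Z₂, rfl, h₁, h₂⟩ := runSubst_cut h
    exact ⟨Z₁, true :: Z₂, rfl, h₁, by simp [h₂, runSubst]⟩
  · left
    have hw' : w = List.replicate w.length false :=
      List.eq_replicate_of_mem fun x hx => by cases x <;> simp_all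
    have hlen : w.length < 2 * l := by
      by_contra! hlen
      refine not_infix_replicate_runSubst hl h000 (List.IsInfix.trans ?_ h0)
      rw [hw']
      refine ⟨List.replicate (w.length - 2 * l) false, [], ?_⟩
      rw [← List.replicate_one, List.append_nil, List.replicate_append_replicate,
        List.replicate_append_replicate]
      congr 1
      omega
    rw [hw']
    refine ⟨List.replicate (2 * l - 1 - w.length) false, ?_⟩
    rw [List.replicate_append_replicate]
    congr 1
    omega

theorem List.IsChain.of_isInfix {α : Type*} {R : α → α → Prop} {u v : List α}
    (h : v.IsChain R) (huv : u <:+: v) : u.IsChain R := by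
  obtain ⟨a, b, rfl⟩ := huv
  exact h.left_of_append.right_of_append

theorem isPrefix_of_isChain_ne {u v : List Bool} {c : Bool} (hu : (c :: u).IsChain (· ≠ ·))
    (hv : (c :: v).IsChain (· ≠ ·)) (h : u.length ≤ v.length) : c :: u <+: c :: v := by
  induction u generalizing c v with
  | nil => simp
  | cons d u ih =>
    cases v with
    | nil => simp at h
    | cons e v =>
      rw [List.isChain_cons_cons] at hu hv
      obtain rfl : d = e := by
        have h₁ := hu.1
        have h₂ := hv.1
        revert h₁ h₂
        cases c <;> cases d <;> cases e <;> simp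
      exact List.cons_prefix_cons.2 ⟨rfl, ih hu.2 hv.2 (by simpa using h)⟩

theorem isSuffix_of_isChain_ne {u v : List Bool} {c : Bool} (hu : (u ++ [c]).IsChain (· ≠ ·))
    (hv : (v ++ [c]).IsChain (· ≠ ·)) (h : u.length ≤ v.length) : u ++ [c] <:+ v ++ [c] := by
  have key : c :: u.reverse <+: c :: v.reverse := by
    refine isPrefix_of_isChain_ne ?_ ?_ (by simpa using h)
    · have h : (u ++ [c]).reverse.IsChain (· ≠ ·) :=
        List.isChain_reverse.2 (by simpa [ne_comm] using hu)
      simpa using h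
    · have h : (v ++ [c]).reverse.IsChain (· ≠ ·) :=
        List.isChain_reverse.2 (by simpa [ne_comm] using hv)
      simpa using h
  simpa using key.reverse

theorem isChain_ne_of_forall_not_square {w : List Bool} (h00 : ¬ [false, false] <:+: w)
    (h11 : ¬ [true, true] <:+: w) : w.IsChain (· ≠ ·) := by
  induction w with
  | nil => exact List.isChain_nil
  | cons c w ih =>
    have hw := ih (fun h => h00 (h.trans (List.suffix_cons c w).isInfix))
      (fun h => h11 (h.trans (List.suffix_cons c w).isInfix))
    cases w with
    | nil => exact List.isChain_singleton _
    | cons d w =>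
      refine List.isChain_cons_cons.2 ⟨?_, hw⟩
      rintro rfl
      cases c
      · exact h00 ⟨[], w, rfl⟩
      · exact h11 ⟨[], w, rfl⟩

theorem altSubst_succ_false (g : ℕ) :
    altSubst (g + 1) false = false :: true :: altSubst g false := by
  simp [altSubst, List.replicate_succ]

theorem length_altSubst_false (g : ℕ) : (altSubst g false).length = 2 * g + 1 := by
  simp [altSubst, mul_comm]

theorem isChain_altSubst_false (g : ℕ) : (altSubst g false).IsChain (· ≠ ·) := by
  induction g with
  | zero => simp [altSubst]
  | succ g ih =>
    rw [altSubst_succ_false]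
    refine List.isChain_cons_cons.2 ⟨by simp, ?_⟩
    obtain ⟨t, ht⟩ := prefix_altSubst g false
    rw [← ht] at ih ⊢
    exact List.isChain_cons_cons.2 ⟨by simp, ih⟩

theorem altSubst_cut {g : ℕ} {Z a r : List Bool}
    (h : a ++ [false] ++ false :: r = Z.flatMap (altSubst g)) :
    ∃ Z₁ Z₂, Z = Z₁ ++ Z₂ ∧ Z₁.flatMap (altSubst g) = a ++ [false] ∧
      Z₂.flatMap (altSubst g) = false :: r := by
  obtain ⟨Z₁, c, Z₂, a', rfl, ha, h₁, h₂⟩ := exists_cut_of_append_eq_flatMap h (by simp)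
  rcases List.eq_nil_or_concat a' with rfl | ⟨a', d, rfl⟩
  · exact ⟨Z₁, c :: Z₂, rfl, by simpa using ha.symm, by simpa using h₁.symm⟩
  · exfalso
    rw [List.concat_eq_append] at *
    obtain rfl : false = d := by
      rw [← List.append_assoc] at ha
      simpa using (List.append_inj' ha rfl).2
    cases c with
    | true => simp [altSubst] at h₂
    | false =>
      have h₃ : a' ++ [false] ++ [false] <+: altSubst g false :=
        List.prefix_of_prefix_length_le (l₃ := a' ++ [false] ++ false :: r) (by simp)
          (by rw [h₁]; exact List.prefix_append _ _) (by simp at h₂ ⊢; omega)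
      have h₄ := (isChain_altSubst_false g).of_isInfix h₃.isInfix
      have h₅ := h₄.of_isInfix (u := [false, false]) ⟨a', [], by simp⟩
      simp at h₅

theorem not_infix_zero_zero_zero_altSubst {g : ℕ} (hg : 1 ≤ g) {Z : List Bool} :
    ¬ [false, false, false] <:+: Z.flatMap (altSubst g) := by
  rintro ⟨a, b, h⟩
  obtain ⟨Z₁, Z₂, rfl, -, h⟩ := altSubst_cut (r := false :: b) (by simpa using h)
  obtain ⟨Z₃, rfl⟩ := head_eq_of_flatMap_eq_cons (prefix_altSubst g) h
  obtain ⟨k, rfl⟩ := Nat.exists_eq_add_of_le' hg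
  rw [List.flatMap_cons, altSubst_succ_false] at h
  simp at h

theorem not_infix_one_one_altSubst {g : ℕ} {Z : List Bool}
    (hZ : ¬ [true, true] <:+: Z) : ¬ [true, true] <:+: Z.flatMap (altSubst g) := by
  rintro ⟨a, b, h⟩
  rw [List.append_assoc] at h
  obtain ⟨Z₁, c, Z₂, a', rfl, -, h₁, h₂⟩ := exists_cut_of_append_eq_flatMap h (by simp)
  cases c with
  | true =>
    obtain rfl : a' = [] := by simpa [altSubst] using h₂
    obtain ⟨Z₃, rfl⟩ := head_eq_of_flatMap_eq_cons (prefix_altSubst g) (Z := Z₂)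
      (c := true) (b := b) (by simpa [altSubst] using h₁.symm)
    exact hZ ⟨Z₁, Z₃, by simp⟩
  | false =>
    have h₃ : a' ++ [true] <+: altSubst g false := List.prefix_of_prefix_length_le
      (l₃ := a' ++ ([true, true] ++ b)) (by simp) (by rw [h₁]; exact List.prefix_append _ _)
      (by simp at h₂ ⊢; omega)
    rcases (Nat.succ_le_of_lt h₂).eq_or_lt with h₄ | h₄
    · have h₅ := h₃.eq_of_length (by simpa using h₄)
      simp [altSubst] at h₅
    · have h₅ : a' ++ [true, true] <+: altSubst g false := List.prefix_of_prefix_length_le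
        (l₃ := a' ++ ([true, true] ++ b)) (by simp) (by rw [h₁]; exact List.prefix_append _ _)
        (by simp at h₄ ⊢; omega)
      have h₆ := (isChain_altSubst_false g).of_isInfix
        ((List.suffix_append a' [true, true]).isInfix.trans h₅.isInfix)
      simp at h₆

theorem flatMap_altSubst_eq_append {g m : ℕ} {Z b : List Bool}
    (h : Z.flatMap (altSubst g) = (List.replicate (g + 1 + m) [false, true]).flatten ++ b) :
    ∃ Z', Z = false :: true :: Z' ∧
      Z'.flatMap (altSubst g) = (List.replicate m [false, true]).flatten ++ b := by
  obtain ⟨Y, rfl⟩ := head_eq_of_flatMap_eq_cons (prefix_altSubst g) (Z := Z) (c := false)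
    (h.trans (by rw [show g + 1 + m = g + m + 1 by ring, List.replicate_succ]; rfl))
  rw [add_assoc, List.replicate_add, List.flatten_append, List.flatMap_cons, altSubst,
    List.append_assoc, List.append_assoc, List.append_cancel_left_eq, add_comm 1 m,
    List.replicate_succ] at h
  replace h : Y.flatMap (altSubst g) =
    true :: ((List.replicate m [false, true]).flatten ++ b) := by simpa using h
  obtain ⟨Y', rfl⟩ := head_eq_of_flatMap_eq_cons (prefix_altSubst g) h
  exact ⟨Y', rfl, by simpa [altSubst] using h⟩

theorem isChain_flatten_replicate (k : ℕ) :
    (List.replicate k [false, true]).flatten.IsChain (· ≠ ·) :=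
  (isChain_altSubst_false k).of_isInfix (List.prefix_append _ _).isInfix

theorem isChain_cons_flatten_replicate (k : ℕ) :
    (true :: (List.replicate k [false, true]).flatten).IsChain (· ≠ ·) := by
  have h := isChain_flatten_replicate (k + 1)
  rw [List.replicate_succ, List.flatten_cons] at h
  exact h.of_isInfix ⟨[false], [], by simp⟩

theorem not_infix_alternating_altSubst {g : ℕ} {Z : List Bool}
    (h101 : ¬ [true, false, true] <:+: Z) :
    ¬ true :: (List.replicate (2 * g + 1) [false, true]).flatten <:+:
      Z.flatMap (altSubst g) := by
  rintro ⟨a, b, h⟩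
  rw [List.append_assoc] at h
  obtain ⟨Z₁, c, Z₂, a', rfl, -, h₁, h₂⟩ := exists_cut_of_append_eq_flatMap h (by simp)
  cases c with
  | true =>
    obtain rfl : a' = [] := by simpa [altSubst] using h₂
    have h₃ : Z₂.flatMap (altSubst g) =
        (List.replicate (g + 1 + g) [false, true]).flatten ++ b := by
      rw [show g + 1 + g = 2 * g + 1 by ring]
      simpa [altSubst] using h₁.symm
    obtain ⟨Y, rfl, -⟩ := flatMap_altSubst_eq_append h₃
    exact h101 ⟨Z₁, Y, by simp⟩
  | false =>
    have h₃ : a' ++ [true] <+: altSubst g false := List.prefix_of_prefix_length_le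
      (l₃ := a' ++ (true :: (List.replicate (2 * g + 1) [false, true]).flatten ++ b)) (by simp)
      (by rw [h₁]; exact List.prefix_append _ _) (by simp at h₂ ⊢; omega)
    have hchain := List.isChain_split.2
      ⟨(isChain_altSubst_false g).of_isInfix h₃.isInfix, isChain_cons_flatten_replicate (2 * g + 1)⟩
    cases a' with
    | nil =>
      obtain ⟨t, ht⟩ := prefix_altSubst g false
      rw [← ht] at h₁
      simp at h₁
    | cons d a' =>
      obtain rfl : d = false := by
        obtain ⟨t, ht⟩ := prefix_altSubst g false
        rw [← ht] at h₁
        simpa using congrArg List.head? h₁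
      obtain ⟨b', hb'⟩ : (List.replicate (2 * g + 2) [false, true]).flatten <+:
          false :: (a' ++ true :: (List.replicate (2 * g + 1) [false, true]).flatten) := by
        have h₄ := isChain_flatten_replicate (2 * g + 2)
        rw [List.replicate_succ, List.flatten_cons] at h₄ ⊢
        exact isPrefix_of_isChain_ne h₄ hchain (by simp)
      have h₅ : (false :: Z₂).flatMap (altSubst g) =
          (List.replicate (g + 1 + (g + 1 + 0)) [false, true]).flatten ++ (b' ++ b) := by
        rw [show g + 1 + (g + 1 + 0) = 2 * g + 2 by ring, ← List.append_assoc, hb',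
          List.flatMap_cons, ← h₁]
        simp
      obtain ⟨Y, hY, h₆⟩ := flatMap_altSubst_eq_append h₅
      obtain ⟨Y', rfl, -⟩ := flatMap_altSubst_eq_append h₆
      exact h101 ⟨Z₁ ++ [false], Y', by rw [hY]; simp⟩

theorem altSubst_rightSpecial {g : ℕ} {Z w : List Bool}
    (h11 : ¬ [true, true] <:+: Z) (h101 : ¬ [true, false, true] <:+: Z)
    (h0 : w ++ [false] <:+: Z.flatMap (altSubst g))
    (h1 : w ++ [true] <:+: Z.flatMap (altSubst g)) :
    w <:+ altSubst (2 * g) false ∨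
      ∃ u, u ++ [false] <:+: Z ∧ u ++ [true] <:+: Z ∧ w <:+ u.flatMap (altSubst g) := by
  by_cases hw : [false, false] <:+: w
  · right
    obtain ⟨s, t, rfl⟩ := hw
    have key : s ++ [false, false] ++ t = (s ++ [false]) ++ (false :: t) := by simp
    rw [key] at h0 h1 ⊢
    refine exists_desubstitution (prefix_altSubst g) (suffix_altSubst g) ?_ h0 h1
    intro a b h
    obtain ⟨Z₁, Z₂, rfl, h₁, h₂⟩ := altSubst_cut (a := a ++ s) (r := t ++ b) (by simpa using h)
    exact ⟨Z₁, Z₂, rfl, by simpa using h₁, h₂⟩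
  · left
    have hchain : (w ++ [true]).IsChain (· ≠ ·) := by
      refine isChain_ne_of_forall_not_square ?_ fun h => not_infix_one_one_altSubst h11 (h.trans h1)
      rintro ⟨a, b, h⟩
      rcases List.eq_nil_or_concat b with rfl | ⟨b, d, rfl⟩
      · simpa using congrArg List.getLast? h
      · rw [List.concat_eq_append, ← List.append_assoc] at h
        exact hw ⟨a, b, (List.append_inj' h rfl).1⟩
    have hlast (k : ℕ) : (List.replicate (k + 1) [false, true]).flatten =
        altSubst k false ++ [true] := by
      simp [altSubst, List.replicate_succ']
    by_cases hlen : w.length ≤ 4 * g + 1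
    · have h := isSuffix_of_isChain_ne (v := altSubst (2 * g) false) hchain
        (by rw [← hlast]; exact isChain_flatten_replicate _)
        (by rw [length_altSubst_false]; omega)
      exact (List.suffix_append_inj_of_length_eq (by simp)).1 h |>.1
    · exfalso
      have h := isSuffix_of_isChain_ne (u := true :: altSubst (2 * g) false) (v := w)
        (by
          rw [List.cons_append, ← hlast]
          exact isChain_cons_flatten_replicate _) hchain
        (by simp [length_altSubst_false]; omega)
      rw [List.cons_append, ← hlast] at h
      exact not_infix_alternating_altSubst h101 (h.isInfix.trans h1)

/-- The composed substitution `0 ↦ ((01)^g 0)^l`, `1 ↦ 1` applied to a word. -/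
def towerMap (l g : ℕ) (w : List Bool) : List Bool :=
  (w.flatMap (runSubst l)).flatMap (altSubst g)

theorem flatMap_flatten_replicate {α β : Type*} (f : α → List β) (k : ℕ) (w : List α) :
    (List.replicate k w).flatten.flatMap f = (List.replicate k (w.flatMap f)).flatten := by
  induction k with
  | zero => simp
  | succ k ih => simp [List.replicate_succ, ih]

theorem towerMap_append (l g : ℕ) (u v : List Bool) :
    towerMap l g (u ++ v) = towerMap l g u ++ towerMap l g v := by
  simp [towerMap]

theorem towerMap_flatten_replicate (l g k : ℕ) (w : List Bool) :
    towerMap l g (List.replicate k w).flatten =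
      (List.replicate k (towerMap l g w)).flatten := by
  simp only [towerMap, flatMap_flatten_replicate]

theorem towerMap_true (l g : ℕ) : towerMap l g [true] = [true] := by
  simp [towerMap, runSubst, altSubst]

theorem towerMap_suffix {l g : ℕ} {u v : List Bool} (h : u <:+ v) :
    towerMap l g u <:+ towerMap l g v := by
  obtain ⟨t, rfl⟩ := h
  exact ⟨towerMap l g t, (towerMap_append ..).symm⟩

theorem flatMap_replicate_false (k g : ℕ) :
    (List.replicate k false).flatMap (altSubst g) =
      (List.replicate k (altSubst g false)).flatten := by
  induction k with
  | zero => simp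
  | succ k ih => simp [List.replicate_succ, ih]

/-- The word `(B_n 1)^{γ_n} B_n`. -/
def powBlock (L γ : ℕ → ℕ) (n : ℕ) : List Bool :=
  (List.replicate (γ n) (Cseq L γ n ++ [true])).flatten ++ Cseq L γ n

/-- The maximal word `(B_n 1)^{2 γ_n} B_n` of the second case. -/
def spacerBranch (L γ : ℕ → ℕ) (n : ℕ) : List Bool :=
  (List.replicate (2 * γ n) (Cseq L γ n ++ [true])).flatten ++ Cseq L γ n

/-- The maximal word `((B_n 1)^{γ_n} B_n)^{L_n - 1} B_{n+1}` of the third case. -/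
def squareBranch (L γ : ℕ → ℕ) (n : ℕ) : List Bool :=
  (List.replicate (L n - 1) (powBlock L γ n)).flatten ++ Cseq L γ (n + 1)

section Cseq

variable {L γ : ℕ → ℕ}

theorem Cseq_succ_s15 {n : ℕ} (hn : 1 ≤ n) :
    Cseq L γ (n + 1) = (List.replicate (L n) (powBlock L γ n)).flatten := by
  obtain ⟨k, rfl⟩ := Nat.exists_eq_add_of_le' hn
  rfl

theorem powBlock_one : powBlock L γ 1 = altSubst (γ 1) false := rfl

theorem Cseq_two : Cseq L γ 2 = towerMap (L 1) (γ 1) [false] := by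
  rw [Cseq_succ_s15 le_rfl, powBlock_one]
  simp [towerMap, runSubst, flatMap_replicate_false]

theorem towerMap_Cseq {n : ℕ} (hn : 1 ≤ n) :
    towerMap (L 1) (γ 1) (Cseq (fun k => L (k + 1)) (fun k => γ (k + 1)) n) =
      Cseq L γ (n + 1) := by
  induction n, hn using Nat.le_induction with
  | base => exact Cseq_two.symm
  | succ n hn ih =>
    rw [Cseq_succ_s15 hn, Cseq_succ_s15 (by omega : 1 ≤ n + 1)]
    simp only [powBlock, towerMap_append, towerMap_flatten_replicate, ih, towerMap_true]

theorem towerMap_spacerBranch {n : ℕ} (hn : 1 ≤ n) :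
    towerMap (L 1) (γ 1) (spacerBranch (fun k => L (k + 1)) (fun k => γ (k + 1)) n) =
      spacerBranch L γ (n + 1) := by
  simp only [spacerBranch, towerMap_append, towerMap_flatten_replicate, towerMap_Cseq hn,
    towerMap_true]

theorem towerMap_squareBranch {n : ℕ} (hn : 1 ≤ n) :
    towerMap (L 1) (γ 1) (squareBranch (fun k => L (k + 1)) (fun k => γ (k + 1)) n) =
      squareBranch L γ (n + 1) := by
  simp only [squareBranch, powBlock, towerMap_append, towerMap_flatten_replicate,
    towerMap_Cseq hn, towerMap_Cseq (hn.trans n.le_succ), towerMap_true]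

theorem squareBranch_one (hL : 1 ≤ L 1) :
    squareBranch L γ 1 = (List.replicate (2 * L 1 - 1) false).flatMap (altSubst (γ 1)) := by
  rw [squareBranch, Cseq_succ_s15 le_rfl, ← List.flatten_append, List.replicate_append_replicate,
    powBlock_one, flatMap_replicate_false]
  congr 2
  omega

theorem not_infix_Cseq (hL : ∀ n, 1 ≤ n → 2 ≤ L n) (hγ : ∀ n, 1 ≤ n → 2 ≤ γ n) {n : ℕ}
    (hn : 1 ≤ n) :
    ¬ [true, true] <:+: Cseq L γ n ∧ ¬ [false, false, false] <:+: Cseq L γ n := by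
  induction n, hn using Nat.le_induction generalizing L γ with
  | base =>
    exact ⟨fun h => by simpa [Cseq] using h.length_le, fun h => by simpa [Cseq] using h.length_le⟩
  | succ n hn ih =>
    rw [← towerMap_Cseq hn]
    have h := ih (fun k _ => hL (k + 1) (by omega)) (fun k _ => hγ (k + 1) (by omega))
    have hL1 := hL 1 le_rfl
    have hγ1 := hγ 1 le_rfl
    exact ⟨not_infix_one_one_altSubst (not_infix_one_one_runSubst (by omega) h.1),
      not_infix_zero_zero_zero_altSubst (by omega)⟩

theorem suffix_branch_of_rightSpecial (hL : ∀ n, 1 ≤ n → 2 ≤ L n) (hγ : ∀ n, 1 ≤ n → 2 ≤ γ n)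
    {n : ℕ} (hn : 1 ≤ n) {w : List Bool} (h0 : w ++ [false] <:+: Cseq L γ n)
    (h1 : w ++ [true] <:+: Cseq L γ n) :
    ∃ m, 1 ≤ m ∧ (w <:+ spacerBranch L γ m ∨ w <:+ squareBranch L γ m) := by
  induction n, hn using Nat.le_induction generalizing L γ w with
  | base =>
    have h := h1.subset (a := true) (by simp)
    simp [Cseq] at h
  | succ n hn ih =>
    have hL' : ∀ k, 1 ≤ k → 2 ≤ L (k + 1) := fun k _ => hL (k + 1) (by omega)
    have hγ' : ∀ k, 1 ≤ k → 2 ≤ γ (k + 1) := fun k _ => hγ (k + 1) (by omega)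
    have hL1 := hL 1 le_rfl
    rw [← towerMap_Cseq hn] at h0 h1
    obtain ⟨h11, h000⟩ := not_infix_Cseq hL' hγ' hn
    rcases altSubst_rightSpecial (not_infix_one_one_runSubst (by omega) h11)
      (not_infix_one_zero_one_runSubst hL1) h0 h1 with h | ⟨v, hv0, hv1, hwv⟩
    · exact ⟨1, le_rfl, .inl h⟩
    rcases runSubst_rightSpecial (by omega) h11 h000 hv0 hv1 with h | ⟨u, hu0, hu1, hvu⟩
    · refine ⟨1, le_rfl, .inr ?_⟩
      rw [squareBranch_one (by omega)]
      obtain ⟨t, ht⟩ := h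
      rw [← ht, List.flatMap_append]
      exact hwv.trans (List.suffix_append _ _)
    · have hwu : w <:+ towerMap (L 1) (γ 1) u := by
        obtain ⟨t, ht⟩ := hvu
        rw [towerMap, ← ht, List.flatMap_append]
        exact hwv.trans (List.suffix_append _ _)
      obtain ⟨m, hm, h | h⟩ := ih hL' hγ' hu0 hu1
      · exact ⟨m + 1, by omega, .inl (towerMap_spacerBranch (L := L) (γ := γ) hm ▸
          hwu.trans (towerMap_suffix h))⟩
      · exact ⟨m + 1, by omega, .inr (towerMap_squareBranch (L := L) (γ := γ) hm ▸
          hwu.trans (towerMap_suffix h))⟩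

theorem zero_suffix_Cseq (hL : ∀ n, 1 ≤ n → 2 ≤ L n) {n : ℕ} (hn : 1 ≤ n) :
    [false] <:+ Cseq L γ n := by
  induction n, hn using Nat.le_induction with
  | base => exact List.suffix_rfl
  | succ n hn ih =>
    obtain ⟨k, hk⟩ := Nat.exists_eq_add_of_le' (hL n hn)
    rw [Cseq_succ_s15 hn, hk, List.replicate_succ', List.flatten_append, List.flatten_singleton]
    exact ih.trans ((List.suffix_append _ _).trans (List.suffix_append _ _))

theorem zero_suffix_powBlock (hL : ∀ n, 1 ≤ n → 2 ≤ L n) {n : ℕ} (hn : 1 ≤ n) :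
    [false] <:+ powBlock L γ n :=
  (zero_suffix_Cseq hL hn).trans (List.suffix_append _ _)

theorem one_Cseq_suffix_powBlock (hγ : ∀ n, 1 ≤ n → 2 ≤ γ n) {n : ℕ} (hn : 1 ≤ n) :
    true :: Cseq L γ n <:+ powBlock L γ n := by
  obtain ⟨k, hk⟩ := Nat.exists_eq_add_of_le' (hγ n hn)
  rw [powBlock, hk, List.replicate_succ']
  exact ⟨(List.replicate (k + 1) (Cseq L γ n ++ [true])).flatten ++ Cseq L γ n, by simp⟩

theorem zero_powBlock_suffix_Cseq (hL : ∀ n, 1 ≤ n → 2 ≤ L n) {n : ℕ} (hn : 1 ≤ n) :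
    false :: powBlock L γ n <:+ Cseq L γ (n + 1) := by
  obtain ⟨k, hk⟩ := Nat.exists_eq_add_of_le' (hL n hn)
  obtain ⟨t, ht⟩ := zero_suffix_powBlock (γ := γ) hL hn
  rw [Cseq_succ_s15 hn, hk, List.replicate_succ', List.replicate_succ', List.flatten_append,
    List.flatten_append, List.flatten_singleton]
  refine ⟨(List.replicate k (powBlock L γ n)).flatten ++ t, ?_⟩
  conv_rhs => rw [← ht]
  conv_lhs => rw [← ht]
  simp

theorem powBlock_suffix_Cseq (hL : ∀ n, 1 ≤ n → 2 ≤ L n) {n : ℕ} (hn : 1 ≤ n) :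
    powBlock L γ n <:+ Cseq L γ (n + 1) :=
  (List.suffix_cons _ _).trans (zero_powBlock_suffix_Cseq hL hn)

theorem one_powBlock_suffix_spacerBranch (hγ : ∀ n, 1 ≤ n → 2 ≤ γ n) {n : ℕ} (hn : 1 ≤ n) :
    true :: powBlock L γ n <:+ spacerBranch L γ n := by
  obtain ⟨k, hk⟩ := Nat.exists_eq_add_of_le' (hγ n hn)
  rw [powBlock, spacerBranch, two_mul, List.replicate_add, List.flatten_append]
  refine List.IsSuffix.append_same (u := true :: (List.replicate (γ n) _).flatten) ?_ _
  refine List.IsSuffix.append_same (u := [true]) ?_ _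
  rw [hk, List.replicate_succ']
  exact ⟨(List.replicate (k + 1) (Cseq L γ n ++ [true])).flatten ++ Cseq L γ n, by simp⟩

theorem zero_Cseq_suffix_squareBranch (hL : ∀ n, 1 ≤ n → 2 ≤ L n) {n : ℕ} (hn : 1 ≤ n) :
    false :: Cseq L γ (n + 1) <:+ squareBranch L γ n := by
  refine List.IsSuffix.append_same (u := [false]) ?_ _
  obtain ⟨k, hk⟩ := Nat.exists_eq_add_of_le' (hL n hn)
  rw [hk, show k + 2 - 1 = k + 1 by omega, List.replicate_succ', List.flatten_append,
    List.flatten_singleton]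
  exact (zero_suffix_powBlock hL hn).trans (List.suffix_append _ _)

theorem length_powBlock (n : ℕ) :
    (powBlock L γ n).length = (γ n + 1) * (Cseq L γ n).length + γ n := by
  simp [powBlock]
  ring

theorem length_spacerBranch (n : ℕ) :
    (spacerBranch L γ n).length = (2 * γ n + 1) * (Cseq L γ n).length + 2 * γ n := by
  simp [spacerBranch]
  ring

theorem length_Cseq_succ {n : ℕ} (hn : 1 ≤ n) :
    (Cseq L γ (n + 1)).length = L n * (powBlock L γ n).length := by
  simp [Cseq_succ_s15 hn]

theorem length_squareBranch (n : ℕ) :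
    (squareBranch L γ n).length =
      (L n - 1) * (powBlock L γ n).length + (Cseq L γ (n + 1)).length := by
  simp [squareBranch]

theorem length_Cseq_lt (hL : ∀ n, 1 ≤ n → 2 ≤ L n) {n : ℕ} (hn : 1 ≤ n) :
    2 * (Cseq L γ n).length ≤ (Cseq L γ (n + 1)).length ∧
      (Cseq L γ n).length < (Cseq L γ (n + 1)).length := by
  have hpos := (zero_suffix_Cseq (γ := γ) hL hn).length_le
  have hle : (Cseq L γ n).length ≤ (powBlock L γ n).length := (List.suffix_append _ _).length_le
  have h := Nat.mul_le_mul (hL n hn) hle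
  rw [← length_Cseq_succ hn] at h
  simp only [List.length_singleton] at hpos
  omega

theorem length_Cseq_mono (hL : ∀ n, 1 ≤ n → 2 ≤ L n) {m n : ℕ} (hm : 1 ≤ m) (hmn : m ≤ n) :
    (Cseq L γ m).length ≤ (Cseq L γ n).length := by
  induction n, hmn using Nat.le_induction with
  | base => exact le_rfl
  | succ n hn ih => exact ih.trans (length_Cseq_lt hL (hm.trans hn)).2.le

theorem Cseq_suffix_Cseq (hL : ∀ n, 1 ≤ n → 2 ≤ L n) {m n : ℕ} (hm : 1 ≤ m) (hmn : m ≤ n) :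
    Cseq L γ m <:+ Cseq L γ n := by
  induction n, hmn using Nat.le_induction with
  | base => exact List.suffix_rfl
  | succ n hn ih =>
    exact ih.trans ((List.suffix_append _ _).trans (powBlock_suffix_Cseq hL (hm.trans hn)))

theorem Cseq_infix_Cseq (hL : ∀ n, 1 ≤ n → 2 ≤ L n) {m n : ℕ} (hn : 1 ≤ n) (hmn : m ≤ n) :
    Cseq L γ m <:+: Cseq L γ n := by
  rcases Nat.eq_zero_or_pos m with rfl | hm
  · exact (Cseq_suffix_Cseq hL le_rfl hn).isInfix
  · exact (Cseq_suffix_Cseq hL hm hmn).isInfix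

theorem exists_case1_of_suffix (hL : ∀ n, 1 ≤ n → 2 ≤ L n) {m : ℕ} (hm : 1 ≤ m) {w : List Bool}
    (hw : 1 < w.length) (h : w <:+ Cseq L γ m) : ∃ n, 1 ≤ n ∧ Case1 L γ w n := by
  induction m, hm using Nat.le_induction with
  | base =>
    have := h.length_le
    simp [Cseq] at this
    omega
  | succ m hm ih =>
    by_cases hlen : w.length ≤ (Cseq L γ m).length
    · exact ih (List.suffix_of_suffix_length_le h (Cseq_suffix_Cseq hL hm m.le_succ) hlen)
    · exact ⟨m, hm, h, not_le.1 hlen, h.length_le⟩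

theorem exists_case (hL : ∀ n, 1 ≤ n → 2 ≤ L n) (hγ : ∀ n, 1 ≤ n → 2 ≤ γ n) {w : List Bool}
    (hrs : RightSpecialC L γ w) (hw : 1 < w.length) :
    ∃ n, 1 ≤ n ∧ (Case1 L γ w n ∨ Case2 L γ w n ∨ Case3 L γ w n) := by
  obtain ⟨⟨i, hi⟩, ⟨j, hj⟩⟩ := hrs
  obtain ⟨m, hm, h | h⟩ := suffix_branch_of_rightSpecial hL hγ (n := i + j + 1) (by omega)
    (hi.trans (Cseq_infix_Cseq hL (by omega) (by omega)))
    (hj.trans (Cseq_infix_Cseq hL (by omega) (by omega)))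
  · by_cases hlen : w.length ≤ (powBlock L γ m).length
    · obtain ⟨n, hn, hc⟩ := exists_case1_of_suffix hL (by omega : 1 ≤ m + 1) hw
        ((List.suffix_of_suffix_length_le h ((List.suffix_cons _ _).trans
          (one_powBlock_suffix_spacerBranch hγ hm)) hlen).trans (powBlock_suffix_Cseq hL hm))
      exact ⟨n, hn, .inl hc⟩
    · refine ⟨m, hm, .inr (.inl ⟨h, ?_, ?_⟩)⟩
      · rw [← length_powBlock]
        exact not_le.1 hlen
      · rw [← length_spacerBranch]
        exact h.length_le
  · by_cases hlen : w.length ≤ (Cseq L γ (m + 1)).length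
    · obtain ⟨n, hn, hc⟩ := exists_case1_of_suffix hL (by omega : 1 ≤ m + 1) hw
        (List.suffix_of_suffix_length_le h (List.suffix_append _ _) hlen)
      exact ⟨n, hn, .inl hc⟩
    · refine ⟨m + 1, by omega, .inr (.inr ⟨by omega, h, not_le.1 hlen, ?_⟩)⟩
      have hle := h.length_le
      have hL0 : (L m : ℝ) ≠ 0 := by
        have := hL m hm
        exact_mod_cast (by omega : L m ≠ 0)
      rw [length_squareBranch, length_Cseq_succ hm] at hle
      rw [length_Cseq_succ hm, Nat.add_sub_cancel]
      have hle' : (w.length : ℝ) ≤ ((L m : ℝ) - 1) * (powBlock L γ m).length +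
          L m * (powBlock L γ m).length := by
        rw [← Nat.cast_pred (by have := hL m hm; omega)]
        exact_mod_cast hle
      refine hle'.trans (le_of_eq ?_)
      push_cast
      field_simp
      ring

theorem length_bounds_of_case (hL : ∀ n, 1 ≤ n → 2 ≤ L n)
    {w : List Bool} {n : ℕ} (hn : 1 ≤ n) (h : Case1 L γ w n ∨ Case2 L γ w n ∨ Case3 L γ w n) :
    (Cseq L γ n).length < w.length ∧ w.length ≤ (Cseq L γ (n + 1)).length := by
  rcases h with ⟨-, h⟩ | ⟨-, h₁, h₂⟩ | ⟨-, -, h₁, h₂⟩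
  · exact h
  · rw [length_Cseq_succ hn, length_powBlock]
    have h₃ := Nat.mul_le_mul_right ((γ n + 1) * (Cseq L γ n).length + γ n) (hL n hn)
    constructor <;> nlinarith
  · refine ⟨h₁, ?_⟩
    have h₃ := (length_Cseq_lt (γ := γ) hL hn).1
    have h₄ : (0 : ℝ) ≤ 1 / (L (n - 1) : ℝ) * (Cseq L γ n).length := by positivity
    have h₅ : (w.length : ℝ) ≤ 2 * (Cseq L γ n).length := by linarith
    have h₆ : w.length ≤ 2 * (Cseq L γ n).length := by exact_mod_cast h₅
    omega

theorem false_of_suffix_of_suffix {α : Type*} {w A A' q : List α} {a b : α} (hab : a ≠ b)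
    (hw : w <:+ A) (hw' : w <:+ A') (ha : a :: q <:+ A) (hb : b :: q <:+ A')
    (hlen : q.length < w.length) : False := by
  have h₁ : a :: q <:+ w := List.suffix_of_suffix_length_le ha hw hlen
  have h₂ : b :: q <:+ w := List.suffix_of_suffix_length_le hb hw' hlen
  have h₃ := (List.suffix_of_suffix_length_le h₁ h₂ le_rfl).eq_of_length rfl
  exact hab (List.cons.inj h₃).1

theorem not_case1_and_case2 (hL : ∀ n, 1 ≤ n → 2 ≤ L n) (hγ : ∀ n, 1 ≤ n → 2 ≤ γ n)
    {w : List Bool} {n : ℕ} (hn : 1 ≤ n) (h₁ : Case1 L γ w n) (h₂ : Case2 L γ w n) : False :=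
  false_of_suffix_of_suffix (by simp) h₁.1 h₂.1 (zero_powBlock_suffix_Cseq hL hn)
    (one_powBlock_suffix_spacerBranch hγ hn) (by rw [length_powBlock]; exact h₂.2.1)

theorem zero_Cseq_suffix_of_case3 (hL : ∀ n, 1 ≤ n → 2 ≤ L n) {w : List Bool} {n : ℕ}
    (h : Case3 L γ w n) : false :: Cseq L γ n <:+ w := by
  obtain ⟨hn, h₁, h₂, -⟩ := h
  obtain ⟨k, rfl⟩ := Nat.exists_eq_add_of_le' hn
  exact List.suffix_of_suffix_length_le (zero_Cseq_suffix_squareBranch hL (n := k + 1) (by omega))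
    h₁ h₂

theorem not_case1_and_case3 (hL : ∀ n, 1 ≤ n → 2 ≤ L n) (hγ : ∀ n, 1 ≤ n → 2 ≤ γ n)
    {w : List Bool} {n : ℕ} (hn : 1 ≤ n) (h₁ : Case1 L γ w n) (h₃ : Case3 L γ w n) : False :=
  false_of_suffix_of_suffix (by simp) h₁.1 List.suffix_rfl
    ((one_Cseq_suffix_powBlock hγ hn).trans (powBlock_suffix_Cseq hL hn))
    (zero_Cseq_suffix_of_case3 hL h₃) h₁.2.1

theorem not_case2_and_case3 (hL : ∀ n, 1 ≤ n → 2 ≤ L n) (hγ : ∀ n, 1 ≤ n → 2 ≤ γ n)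
    {w : List Bool} {n : ℕ} (hn : 1 ≤ n) (h₂ : Case2 L γ w n) (h₃ : Case3 L γ w n) : False :=
  false_of_suffix_of_suffix (by simp) h₂.1 List.suffix_rfl
    ((one_Cseq_suffix_powBlock hγ hn).trans ((List.suffix_cons _ _).trans
      (one_powBlock_suffix_spacerBranch hγ hn)))
    (zero_Cseq_suffix_of_case3 hL h₃) h₃.2.2.1

end Cseq

/-- Every right-special word `w` of length `> 1` falls into exactly one of the three cases
for a unique `n` (and for `m ≠ n` none of the cases hold); in all cases
`h_n < len(w) ≤ h_{n+1}`. -/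
theorem stmt15 (L γ : ℕ → ℕ) (hL : ∀ n, 1 ≤ n → 2 ≤ L n) (hγ : ∀ n, 1 ≤ n → 2 ≤ γ n)
    (w : List Bool) (hrs : RightSpecialC L γ w) (hlen : 1 < w.length) :
    ∃ n, 1 ≤ n ∧
      ((Case1 L γ w n ∧ ¬ Case2 L γ w n ∧ ¬ Case3 L γ w n) ∨
        (¬ Case1 L γ w n ∧ Case2 L γ w n ∧ ¬ Case3 L γ w n) ∨
        (¬ Case1 L γ w n ∧ ¬ Case2 L γ w n ∧ Case3 L γ w n)) ∧
      ((Cseq L γ n).length < w.length ∧ w.length ≤ (Cseq L γ (n + 1)).length) ∧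
      (∀ m, 1 ≤ m → m ≠ n →
        ¬ Case1 L γ w m ∧ ¬ Case2 L γ w m ∧ ¬ Case3 L γ w m) := by
  obtain ⟨n, hn, hc⟩ := exists_case hL hγ hrs hlen
  have hb := length_bounds_of_case hL hn hc
  have h12 := not_case1_and_case2 (w := w) hL hγ hn
  have h13 := not_case1_and_case3 (w := w) hL hγ hn
  have h23 := not_case2_and_case3 (w := w) hL hγ hn
  refine ⟨n, hn, by tauto, hb, fun m hm hmn => ?_⟩
  by_contra hcon
  have hb' := length_bounds_of_case (γ := γ) (w := w) hL hm (by tauto)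
  rcases hmn.lt_or_gt with h | h
  · have := length_Cseq_mono (γ := γ) hL (by omega : 1 ≤ m + 1) h
    omega
  · have := length_Cseq_mono (γ := γ) hL (by omega : 1 ≤ n + 1) h
    omega
end
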